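/- Let g be even with g ≥ 6, and set u = x_1 + x_2, w = x_3 + x_4 + ⋯ + x_g (the sum of all standard basis vectors with index ≥ 3), and w' = x_5 + x_6 + ⋯ + x_g (the sum of all standard basis vectors with index ≥ 5). Then, as maps V → V, T_u ∘ T_w ∘ T_{u+w} = (T_u ∘ T_{x_3+x_4} ∘ T_{u + x_3 + x_4}) ∘ (T_u ∘ T_{w'} ∘ T_{u + w'}). -/

import Mathlib

/-- `V = H₁(N_g; ℤ/2)` as the space of `ℤ/2`-vectors of length `g`.
The standard basis vector `x_i` (1-based index `i`) is `basis_x g ⟨i-1, _⟩`. -/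
abbrev Vg (g : ℕ) := Fin g → ZMod 2

/-- The standard basis vector (0-based index). -/
def basis_x (g : ℕ) (i : Fin g) : Vg g := Pi.single i 1

/-- The mod-2 intersection form `B(v,w) = ∑ᵢ vᵢ wᵢ`. -/
def Bform (g : ℕ) (v w : Vg g) : ZMod 2 := ∑ i, v i * w i

/-- The number of odd 1-based indices `i` with `vᵢ = 1` (0-based: even indices). -/
def lenOdd (g : ℕ) (v : Vg g) : ℕ :=
  (Finset.univ.filter fun i : Fin g => v i = 1 ∧ i.val % 2 = 0).card

/-- The number of even 1-based indices `i` with `vᵢ = 1` (0-based: odd indices). -/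
def lenEven (g : ℕ) (v : Vg g) : ℕ :=
  (Finset.univ.filter fun i : Fin g => v i = 1 ∧ i.val % 2 = 1).card

/-- The Guillou–Marin quadratic form of the o-standardly embedded `N_g`. -/
def qform (g : ℕ) (v : Vg g) : ZMod 4 := (lenOdd g v : ZMod 4) - (lenEven g v : ZMod 4)

/-- The transvection `T_a : v ↦ v + B(v,a)·a`, as a linear endomorphism of `V`. -/
def Tv (g : ℕ) (a : Vg g) : Module.End (ZMod 2) (Vg g) where
  toFun v := v + Bform g v a • a
  map_add' v w := by
    have h : Bform g (v + w) a = Bform g v a + Bform g w a := by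
      simp [Bform, add_mul, Finset.sum_add_distrib]
    simp only [h, add_smul]
    abel
  map_smul' c v := by
    have h : Bform g (c • v) a = c * Bform g v a := by
      simp [Bform, Finset.mul_sum, mul_assoc]
    simp only [h, RingHom.id_apply, mul_smul, smul_add]

theorem Bform_add_left (g : ℕ) (a b c : Vg g) :
    Bform g (a + b) c = Bform g a c + Bform g b c := by
  simp [Bform, add_mul, Finset.sum_add_distrib]

theorem Bform_add_right (g : ℕ) (a b c : Vg g) :
    Bform g a (b + c) = Bform g a b + Bform g a c := by
  simp [Bform, mul_add, Finset.sum_add_distrib]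

theorem Bform_smul_left (g : ℕ) (r : ZMod 2) (a b : Vg g) :
    Bform g (r • a) b = r * Bform g a b := by
  simp [Bform, Finset.mul_sum, mul_assoc]

theorem Bform_comm (g : ℕ) (a b : Vg g) : Bform g a b = Bform g b a := by
  simp [Bform, mul_comm]

theorem Bform_basis_x_left (g : ℕ) (i : Fin g) (v : Vg g) :
    Bform g (basis_x g i) v = v i := by
  simp [Bform, basis_x, Pi.single_apply]

theorem basis_x_apply (g : ℕ) (i j : Fin g) : basis_x g i j = if j = i then 1 else 0 := by
  simp [basis_x, Pi.single_apply]

theorem Tv_apply (g : ℕ) (a v : Vg g) : Tv g a v = v + Bform g v a • a := rfl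

theorem Tv_mul_Tv_mul_Tv_add_apply (g : ℕ) {u a : Vg g} (huu : Bform g u u = 0)
    (haa : Bform g a a = 0) (hua : Bform g u a = 0) (v : Vg g) :
    (Tv g u * Tv g a * Tv g (u + a)) v = v + Bform g v u • a + Bform g v a • u := by
  have hau : Bform g a u = 0 := by rw [Bform_comm, hua]
  simp only [Module.End.mul_apply, Tv_apply, Bform_add_left, Bform_add_right, Bform_smul_left,
    huu, haa, hua, hau]
  ext i
  simp only [Pi.add_apply, Pi.smul_apply, smul_eq_mul]
  ring_nf
  grind

theorem Bform_ite_self (g : ℕ) (hg : 4 ≤ g) (heven : Even g) :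
    Bform g (fun i => if 4 ≤ i.val then 1 else 0) (fun i => if 4 ≤ i.val then 1 else 0) = 0 := by
  obtain ⟨k, rfl⟩ := Nat.exists_eq_add_of_le' hg
  have hk : Even k := by
    rw [Nat.even_add] at heven
    exact heven.mpr (by decide)
  simpa [Bform, Fin.sum_univ_succ] using (ZMod.natCast_eq_zero_iff_even).mpr hk

/-- For even `g ≥ 6`, with `u = x₁ + x₂`, `w = x₃ + ⋯ + x_g`, `w' = x₅ + ⋯ + x_g`
(1-based indices), one has
`T_u T_w T_{u+w} = (T_u T_{x₃+x₄} T_{u+x₃+x₄}) (T_u T_{w'} T_{u+w'})` as maps. -/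
theorem stmt15 (g : ℕ) (hg : 6 ≤ g) (heven : Even g)
    (u w w' y : Vg g)
    (hu : u = basis_x g ⟨0, by omega⟩ + basis_x g ⟨1, by omega⟩)
    (hw : w = fun i => if 2 ≤ i.val then 1 else 0)
    (hw' : w' = fun i => if 4 ≤ i.val then 1 else 0)
    (hy : y = basis_x g ⟨2, by omega⟩ + basis_x g ⟨3, by omega⟩) :
    Tv g u * Tv g w * Tv g (u + w) =
      (Tv g u * Tv g y * Tv g (u + y)) * (Tv g u * Tv g w' * Tv g (u + w')) := by
  have hwy : w = y + w' := by
    subst hw hw' hy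
    ext i
    simp only [basis_x_apply, Pi.add_apply, Fin.ext_iff]
    split_ifs <;> first | omega | simp
  have huu : Bform g u u = 0 := by
    simp [hu, Bform_add_left, Bform_basis_x_left, basis_x_apply]
    rfl
  have hyy : Bform g y y = 0 := by
    simp [hy, Bform_add_left, Bform_basis_x_left, basis_x_apply]
    rfl
  have huy : Bform g u y = 0 := by
    simp [hu, hy, Bform_add_left, Bform_basis_x_left, basis_x_apply]
  have huw' : Bform g u w' = 0 := by
    simp [hu, hw', Bform_add_left, Bform_basis_x_left]
  have hyw' : Bform g y w' = 0 := by
    simp [hy, hw', Bform_add_left, Bform_basis_x_left]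
  have hw'w' : Bform g w' w' = 0 := by
    rw [hw']
    exact Bform_ite_self g (by omega) heven
  have hw'y : Bform g w' y = 0 := by rw [Bform_comm, hyw']
  have hw'u : Bform g w' u = 0 := by rw [Bform_comm, huw']
  have huw : Bform g u w = 0 := by simp [hwy, Bform_add_right, huy, huw']
  have hww : Bform g w w = 0 := by
    simp [hwy, Bform_add_left, Bform_add_right, hyy, hyw', hw'y, hw'w']
  refine LinearMap.ext fun v => ?_
  rw [Tv_mul_Tv_mul_Tv_add_apply g huu hww huw, Module.End.mul_apply,
    Tv_mul_Tv_mul_Tv_add_apply g huu hw'w' huw', Tv_mul_Tv_mul_Tv_add_apply g huu hyy huy]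
  simp only [hwy, Bform_add_left, Bform_add_right, Bform_smul_left, huu, huy, hw'u, hw'y,
    mul_zero, add_zero]
  module
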